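/- Let f : ℕ → ℕ be a function such that for every n, if the computable linear order L_n is ill-founded, then the column f^[n] majorizes some descending sequence of L_n. Then f is loquaciously high for descending sequences: there is a total function g : ℕ × ℕ → ℕ recursive in f such that whenever L_n is ill-founded, k ↦ g(n,k) is a descending sequence in L_n. -/

import Mathlib

namespace CFT

open Nat.Partrec (Code)

/-- Relativized partial recursive functions: `f` is partial recursive in the
(total) oracle `O : ℕ → ℕ`.  This mirrors Mathlib's `Nat.Partrec`, with an
extra constructor for the oracle. -/
inductive RecursiveIn (O : ℕ → ℕ) : (ℕ →. ℕ) → Prop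
  | zero : RecursiveIn O (pure 0)
  | succ : RecursiveIn O Nat.succ
  | left : RecursiveIn O ↑fun n : ℕ => n.unpair.1
  | right : RecursiveIn O ↑fun n : ℕ => n.unpair.2
  | oracle : RecursiveIn O ↑O
  | pair {f g} : RecursiveIn O f → RecursiveIn O g →
      RecursiveIn O fun n => Nat.pair <$> f n <*> g n
  | comp {f g} : RecursiveIn O f → RecursiveIn O g →
      RecursiveIn O fun n => g n >>= f
  | prec {f g} : RecursiveIn O f → RecursiveIn O g →
      RecursiveIn O (Nat.unpaired fun a n =>
        n.rec (f a) fun y IH => do let i ← IH; g (Nat.pair a (Nat.pair y i)))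
  | rfind {f} : RecursiveIn O f →
      RecursiveIn O fun a => Nat.rfind fun n => (fun m => m = 0) <$> f (Nat.pair a n)

/-- Partial functions between `Primcodable` types that are partial recursive in
the oracle `O`. -/
def PartrecIn (O : ℕ → ℕ) {α σ : Type} [Primcodable α] [Primcodable σ] (f : α →. σ) : Prop :=
  RecursiveIn O fun n =>
    Part.bind (Part.ofOption (Encodable.decode (α := α) n)) fun a => (f a).map Encodable.encode

/-- Total functions between `Primcodable` types that are computable in the oracle `O`. -/
def ComputableIn (O : ℕ → ℕ) {α σ : Type} [Primcodable α] [Primcodable σ] (f : α → σ) : Prop :=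
  PartrecIn O (f : α →. σ)

open Classical in
/-- The characteristic function of a set of naturals. -/
noncomputable def chi (A : Set ℕ) : ℕ → ℕ := fun n => if n ∈ A then 1 else 0

/-- `A` is computably enumerable in (the characteristic function of) `X`. -/
def CEIn (X : Set ℕ) (A : Set ℕ) : Prop :=
  ∃ f : ℕ →. ℕ, PartrecIn (chi X) f ∧ ∀ n, n ∈ A ↔ (f n).Dom

/-- The `e`-th partial computable function `ℕ →. ℕ`. -/
def codeFn (e : ℕ) : ℕ →. ℕ := (Denumerable.ofNat Code e).eval

/-! ### Trees on ℕ -/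

def PrefixClosed (T : Set (List ℕ)) : Prop := ∀ l ∈ T, ∀ l' : List ℕ, l' <+: l → l' ∈ T

/-- Index `e` decides a (prefix-closed) tree on `ℕ`. -/
def DecidesTree (e : ℕ) : Prop :=
  (∀ n, (codeFn e n).Dom) ∧
    PrefixClosed {l : List ℕ | codeFn e (Encodable.encode l) = Part.some 1}

open Classical in
/-- The standard enumeration of computable trees on ℕ; indices that do not
decide a tree denote the empty tree. -/
noncomputable def treeAt (e : ℕ) : Set (List ℕ) :=
  if DecidesTree e then {l : List ℕ | codeFn e (Encodable.encode l) = Part.some 1} else ∅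

/-- `f` is a path through the tree `T`: every finite initial segment
`[f 0, …, f (k-1)]` is in `T`. -/
def IsPath (T : Set (List ℕ)) (f : ℕ → ℕ) : Prop := ∀ k, (List.range k).map f ∈ T

def IllFounded (T : Set (List ℕ)) : Prop := ∃ f, IsPath T f

/-- The set of indices of well-founded computable trees. -/
def WF : Set ℕ := {e | ¬ IllFounded (treeAt e)}

/-- `T` is a computable tree (prefix-closed and decided by a total computable function). -/
def ComputableTree (T : Set (List ℕ)) : Prop :=
  PrefixClosed T ∧ ∃ χ : List ℕ → Bool, Computable χ ∧ ∀ l, l ∈ T ↔ χ l = true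

/-! ### Highness notions for paths -/

def HighForPaths (X : Set ℕ) : Prop :=
  ∀ T : Set (List ℕ), ComputableTree T → IllFounded T →
    ∃ f : ℕ → ℕ, ComputableIn (chi X) f ∧ IsPath T f

def LoqHighForPaths (X : Set ℕ) : Prop :=
  ∃ F : ℕ × ℕ → ℕ, ComputableIn (chi X) F ∧
    ∀ e, IllFounded (treeAt e) → IsPath (treeAt e) fun n => F (e, n)

def UnifHighForPaths (X : Set ℕ) : Prop :=
  ∃ F : ℕ × ℕ →. ℕ, PartrecIn (chi X) F ∧
    ∀ e, IllFounded (treeAt e) →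
      ∃ g : ℕ → ℕ, IsPath (treeAt e) g ∧ ∀ n, F (e, n) = Part.some (g n)

def RetHighForPaths (X : Set ℕ) : Prop :=
  ∃ F : ℕ × ℕ →. ℕ, PartrecIn (chi X) F ∧
    (∀ e, IllFounded (treeAt e) →
      ∃ g : ℕ → ℕ, IsPath (treeAt e) g ∧ ∀ n, F (e, n) = Part.some (g n)) ∧
    (∀ e, ¬ IllFounded (treeAt e) → ∀ n, ¬ (F (e, n)).Dom)

/-! ### Σ¹₁ and Π¹₁ sets -/

def Sigma11 (A : Set ℕ) : Prop :=
  ∃ R : ℕ → List ℕ → Bool, Computable₂ R ∧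
    ∀ n, n ∈ A ↔ ∃ f : ℕ → ℕ, ∀ k, R n ((List.range k).map f) = true

def Pi11 (A : Set ℕ) : Prop := Sigma11 Aᶜ

/-! ### Linear orders -/

/-- A (presentation of a) linear order: a domain `D ⊆ ℕ` and a strict order
relation on it. -/
structure LinOrd where
  dom : Set ℕ
  lt : ℕ → ℕ → Prop

/-- `L` really is a strict linear order on its domain. -/
def LinOrd.IsValid (L : LinOrd) : Prop :=
  (∀ a b, L.lt a b → a ∈ L.dom ∧ b ∈ L.dom) ∧
  (∀ a, ¬ L.lt a a) ∧
  (∀ a b c, L.lt a b → L.lt b c → L.lt a c) ∧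
  (∀ a ∈ L.dom, ∀ b ∈ L.dom, a = b ∨ L.lt a b ∨ L.lt b a)

def linOrdOfCodes (n : ℕ) : LinOrd :=
  ⟨{a | codeFn n.unpair.1 a = Part.some 1},
   fun a b => codeFn n.unpair.2 (Nat.pair a b) = Part.some 1⟩

def DecidesLinOrd (n : ℕ) : Prop :=
  (∀ m, (codeFn n.unpair.1 m).Dom) ∧ (∀ m, (codeFn n.unpair.2 m).Dom) ∧
    (linOrdOfCodes n).IsValid

open Classical in
/-- The standard enumeration of computable linear orders; indices that do not
decide a linear order denote the empty order. -/
noncomputable def linOrdAt (n : ℕ) : LinOrd :=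
  if DecidesLinOrd n then linOrdOfCodes n else ⟨∅, fun _ _ => False⟩

def IsDescSeq (L : LinOrd) (f : ℕ → ℕ) : Prop :=
  ∀ i, f i ∈ L.dom ∧ L.lt (f (i + 1)) (f i)

def LinOrd.IllFounded (L : LinOrd) : Prop := ∃ f, IsDescSeq L f

/-- A tight descending sequence: a descending sequence that gets below every
descending sequence. -/
def IsTightDescSeq (L : LinOrd) (f : ℕ → ℕ) : Prop :=
  IsDescSeq L f ∧ ∀ g, IsDescSeq L g → ∀ n, ∃ m, L.lt (f m) (g n)

/-- `L` is a computable linear order. -/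
def ComputableLinOrd (L : LinOrd) : Prop :=
  L.IsValid ∧
  (∃ χ : ℕ → Bool, Computable χ ∧ ∀ a, a ∈ L.dom ↔ χ a = true) ∧
  (∃ χ : ℕ → ℕ → Bool, Computable₂ χ ∧ ∀ a b, L.lt a b ↔ χ a b = true)

def LoqHighForDS (X : Set ℕ) : Prop :=
  ∃ g : ℕ × ℕ → ℕ, ComputableIn (chi X) g ∧
    ∀ n, (linOrdAt n).IllFounded → IsDescSeq (linOrdAt n) fun k => g (n, k)

def HighForTightDS (X : Set ℕ) : Prop :=
  ∀ L : LinOrd, ComputableLinOrd L → L.IllFounded →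
    ∃ f : ℕ → ℕ, ComputableIn (chi X) f ∧ IsTightDescSeq L f

def UnifHighForTightDS (X : Set ℕ) : Prop :=
  ∃ F : ℕ × ℕ →. ℕ, PartrecIn (chi X) F ∧
    ∀ n, (linOrdAt n).IllFounded →
      ∃ g : ℕ → ℕ, IsTightDescSeq (linOrdAt n) g ∧ ∀ k, F (n, k) = Part.some (g k)

/-! ### Binary trees -/

def PrefixClosedB (B : Set (List Bool)) : Prop := ∀ l ∈ B, ∀ l' : List Bool, l' <+: l → l' ∈ B

def DecidesBTree (e : ℕ) : Prop :=
  (∀ n, (codeFn e n).Dom) ∧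
    PrefixClosedB {l : List Bool | codeFn e (Encodable.encode l) = Part.some 1}

open Classical in
/-- The standard enumeration of computable binary trees; indices that do not
decide a binary tree denote the full binary tree. -/
noncomputable def bTreeAt (e : ℕ) : Set (List Bool) :=
  if DecidesBTree e then {l : List Bool | codeFn e (Encodable.encode l) = Part.some 1}
  else Set.univ

def BInfinite (B : Set (List Bool)) : Prop := ∀ k, ∃ l ∈ B, l.length = k

def IsBPath (B : Set (List Bool)) (p : ℕ → Bool) : Prop := ∀ k, (List.range k).map p ∈ B


/-! ### Functions recursive in an oracle -/

theorem RecursiveIn.of_partrec {O : ℕ → ℕ} {f : ℕ →. ℕ} (hf : Nat.Partrec f) :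
    RecursiveIn O f := by
  induction hf with
  | zero => exact .zero
  | succ => exact .succ
  | left => exact .left
  | right => exact .right
  | pair _ _ ihf ihg => exact .pair ihf ihg
  | comp _ _ ihf ihg => exact .comp ihf ihg
  | prec _ _ ihf ihg => exact .prec ihf ihg
  | rfind _ ihf => exact .rfind ihf

theorem RecursiveIn.of_eq {O : ℕ → ℕ} {f g : ℕ →. ℕ} (hf : RecursiveIn O f)
    (h : ∀ n, f n = g n) : RecursiveIn O g :=
  (funext h : f = g) ▸ hf

theorem RecursiveIn.of_primrec {O : ℕ → ℕ} {f : ℕ → ℕ} (hf : Primrec f) :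
    RecursiveIn O (f : ℕ →. ℕ) :=
  .of_partrec (.of_primrec (Primrec.nat_iff.1 hf))

theorem RecursiveIn.comp_total {O f g : ℕ → ℕ} (hf : RecursiveIn O (f : ℕ →. ℕ))
    (hg : RecursiveIn O (g : ℕ →. ℕ)) : RecursiveIn O ((fun n => f (g n) : ℕ → ℕ) : ℕ →. ℕ) := by
  refine (hf.comp hg).of_eq fun n => ?_
  exact Part.bind_some (g n) (f : ℕ →. ℕ)

theorem RecursiveIn.pair_total {O f g : ℕ → ℕ} (hf : RecursiveIn O (f : ℕ →. ℕ))
    (hg : RecursiveIn O (g : ℕ →. ℕ)) :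
    RecursiveIn O ((fun n => Nat.pair (f n) (g n) : ℕ → ℕ) : ℕ →. ℕ) := by
  refine (hf.pair hg).of_eq fun n => ?_
  simp [Seq.seq]

theorem RecursiveIn.prec_total {O f g : ℕ → ℕ} (hf : RecursiveIn O (f : ℕ →. ℕ))
    (hg : RecursiveIn O (g : ℕ →. ℕ)) :
    RecursiveIn O ((fun p : ℕ => Nat.rec (motive := fun _ => ℕ) (f p.unpair.1)
      (fun y i => g (Nat.pair p.unpair.1 (Nat.pair y i))) p.unpair.2 : ℕ → ℕ) : ℕ →. ℕ) := by
  refine (hf.prec hg).of_eq fun p => ?_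
  simp only [Nat.unpaired, PFun.coe_val]
  induction p.unpair.2 with
  | zero => rfl
  | succ k ih => simp only [ih]; simp

/-! ### Greedy descent below a bound -/

open Classical in
/-- Replace the candidate `c` by `m` if `m` lies below the previous choice `i` and above `c`.
Choices and candidates are shifted by one, `0` standing for their absence. -/
noncomputable def greedyStep (M : LinOrd) (i m c : ℕ) : ℕ :=
  if (m ∈ M.dom ∧ (i = 0 ∨ M.lt m (i - 1))) ∧ (c = 0 ∨ M.lt (c - 1) m) then m + 1 else c

/-- The `M`-largest element less than `b` lying below the previous choice `i`, shifted by one. -/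
noncomputable def greedyMax (M : LinOrd) (i b : ℕ) : ℕ :=
  Nat.rec 0 (greedyStep M i) b

/-- The successive greedy choices of elements of `M` bounded by `F`, shifted by one. -/
noncomputable def greedySeq (M : LinOrd) (F : ℕ → ℕ) (k : ℕ) : ℕ :=
  Nat.rec 0 (fun y i => greedyMax M i (F y + 1)) k

theorem greedyMax_spec {M : LinOrd} (hM : M.IsValid) (i b : ℕ) :
    (greedyMax M i b = 0 ∧ ∀ m < b, ¬ (m ∈ M.dom ∧ (i = 0 ∨ M.lt m (i - 1)))) ∨
    ∃ q, greedyMax M i b = q + 1 ∧ (q ∈ M.dom ∧ (i = 0 ∨ M.lt q (i - 1))) ∧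
      ∀ m < b, (m ∈ M.dom ∧ (i = 0 ∨ M.lt m (i - 1))) → m = q ∨ M.lt m q := by
  obtain ⟨-, -, htrans, htot⟩ := hM
  induction b with
  | zero => exact .inl ⟨rfl, by simp⟩
  | succ b ih =>
    have hstep : greedyMax M i (b + 1) = greedyStep M i b (greedyMax M i b) := rfl
    rw [hstep, greedyStep]
    split_ifs with h
    · refine .inr ⟨b, rfl, h.1, fun m hm hgood => ?_⟩
      rcases Nat.lt_succ_iff_lt_or_eq.1 hm with hm | rfl
      · rcases ih with ⟨_, hno⟩ | ⟨q, hq, _, hmax⟩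
        · exact absurd hgood (hno m hm)
        · have hqb : M.lt q b := by simpa [hq] using h.2
          rcases hmax m hm hgood with rfl | hlt
          · exact .inr hqb
          · exact .inr (htrans _ _ _ hlt hqb)
      · exact .inl rfl
    · rcases ih with ⟨h0, hno⟩ | ⟨q, hq, hgq, hmax⟩
      · refine .inl ⟨h0, fun m hm hgood => ?_⟩
        rcases Nat.lt_succ_iff_lt_or_eq.1 hm with hm | rfl
        · exact hno m hm hgood
        · exact h ⟨hgood, .inl h0⟩
      · refine .inr ⟨q, hq, hgq, fun m hm hgood => ?_⟩
        rcases Nat.lt_succ_iff_lt_or_eq.1 hm with hm | rfl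
        · exact hmax m hm hgood
        · rcases htot m hgood.1 q hgq.1 with he | hlt | hlt
          · exact .inl he
          · exact .inr hlt
          · exact absurd ⟨hgood, .inr (by simpa [hq] using hlt)⟩ h

theorem greedySeq_spec {M : LinOrd} (hM : M.IsValid) {F d : ℕ → ℕ} (hd : IsDescSeq M d)
    (hF : ∀ k, d k ≤ F k) (k : ℕ) :
    ∃ q, greedySeq M F (k + 1) = q + 1 ∧ q ∈ M.dom ∧ (d k = q ∨ M.lt (d k) q) ∧
      (greedySeq M F k = 0 ∨ M.lt q (greedySeq M F k - 1)) := by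
  have key : ∀ k, (greedySeq M F k = 0 ∨ M.lt (d k) (greedySeq M F k - 1)) →
      ∃ q, greedySeq M F (k + 1) = q + 1 ∧ q ∈ M.dom ∧ (d k = q ∨ M.lt (d k) q) ∧
        (greedySeq M F k = 0 ∨ M.lt q (greedySeq M F k - 1)) := fun k hk => by
    rcases greedyMax_spec hM (greedySeq M F k) (F k + 1) with ⟨_, hno⟩ | ⟨q, hq, hgq, hmax⟩
    · exact absurd ⟨(hd k).1, hk⟩ (hno (d k) (Nat.lt_succ_of_le (hF k)))
    · exact ⟨q, hq, hgq.1, hmax (d k) (Nat.lt_succ_of_le (hF k)) ⟨(hd k).1, hk⟩, hgq.2⟩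
  induction k with
  | zero => exact key 0 (.inl rfl)
  | succ k ih =>
    obtain ⟨q, hq, -, hle, -⟩ := ih
    refine key (k + 1) (.inr ?_)
    rw [hq, Nat.add_sub_cancel]
    rcases hle with he | hlt
    · exact he ▸ (hd k).2
    · exact hM.2.2.1 _ _ _ (hd k).2 hlt

theorem isDescSeq_greedySeq {M : LinOrd} (hM : M.IsValid) {F d : ℕ → ℕ} (hd : IsDescSeq M d)
    (hF : ∀ k, d k ≤ F k) : IsDescSeq M fun k => greedySeq M F (k + 1) - 1 := by
  intro k
  obtain ⟨q, hq, hqM, -, -⟩ := greedySeq_spec hM hd hF k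
  obtain ⟨r, hr, -, -, hlt⟩ := greedySeq_spec hM hd hF (k + 1)
  refine ⟨by simpa [hq] using hqM, ?_⟩
  rcases hlt with h0 | hlt
  · omega
  · simpa [hr] using hlt

/-! ### Linear orders with certified elements -/

/-- Within `s` steps, the two codes given by `n` halt on all inputs needed to compare numbers up
to `x`. -/
def HaltsWithin (n x s : ℕ) : Prop :=
  ∀ m < Nat.pair x x + 1, (Code.evaln s (Denumerable.ofNat Code n.unpair.1) m).isSome ∧
    (Code.evaln s (Denumerable.ofNat Code n.unpair.2) m).isSome

/-- `p` codes an element of the `n`-th order together with the least number of steps certifying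
it. -/
def IsCertified (n p : ℕ) : Prop :=
  HaltsWithin n p.unpair.1 p.unpair.2 ∧ (∀ s < p.unpair.2, ¬ HaltsWithin n p.unpair.1 s) ∧
    Code.evaln p.unpair.2 (Denumerable.ofNat Code n.unpair.1) p.unpair.1 = some 1

/-- The comparison of certified elements, evaluated within the certified number of steps. -/
def CertifiedLt (n p q : ℕ) : Prop :=
  IsCertified n p ∧ IsCertified n q ∧
    Code.evaln (p.unpair.2 + q.unpair.2) (Denumerable.ofNat Code n.unpair.2)
      (Nat.pair p.unpair.1 q.unpair.1) = some 1

/-- The copy of the `n`-th computable linear order on its certified elements. -/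
def certifiedOrd (n : ℕ) : LinOrd := ⟨{p | IsCertified n p}, CertifiedLt n⟩

theorem evaln_isSome_mono {s t : ℕ} {c : Code} {m : ℕ} (hst : s ≤ t)
    (h : (Code.evaln s c m).isSome) : (Code.evaln t c m).isSome := by
  obtain ⟨v, hv⟩ := Option.isSome_iff_exists.1 h
  exact Option.isSome_iff_exists.2 ⟨v, Code.evaln_mono hst hv⟩

theorem evaln_eq_some_iff {s e m v : ℕ}
    (h : (Code.evaln s (Denumerable.ofNat Code e) m).isSome) :
    Code.evaln s (Denumerable.ofNat Code e) m = some v ↔ codeFn e m = Part.some v := by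
  obtain ⟨w, hw⟩ := Option.isSome_iff_exists.1 h
  have he : codeFn e m = Part.some w := Part.eq_some_iff.2 (Code.evaln_sound hw)
  rw [hw, he, Option.some_inj, Part.some_inj]

theorem exists_evaln_isSome_of_total {e : ℕ} (h : ∀ m, (codeFn e m).Dom) (b : ℕ) :
    ∃ s, ∀ m < b, (Code.evaln s (Denumerable.ofNat Code e) m).isSome := by
  induction b with
  | zero => exact ⟨0, by simp⟩
  | succ b ih =>
    obtain ⟨s, hs⟩ := ih
    obtain ⟨t, ht⟩ := Code.evaln_complete.1 (Part.get_mem (h b))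
    refine ⟨max s t, fun m hm => ?_⟩
    rcases Nat.lt_succ_iff_lt_or_eq.1 hm with hm | rfl
    · exact evaln_isSome_mono (le_max_left _ _) (hs m hm)
    · exact evaln_isSome_mono (le_max_right _ _) (Option.isSome_iff_exists.2 ⟨_, ht⟩)

theorem exists_haltsWithin {n : ℕ} (h : DecidesLinOrd n) (x : ℕ) : ∃ s, HaltsWithin n x s := by
  obtain ⟨s, hs⟩ := exists_evaln_isSome_of_total h.1 (Nat.pair x x + 1)
  obtain ⟨t, ht⟩ := exists_evaln_isSome_of_total h.2.1 (Nat.pair x x + 1)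
  exact ⟨max s t, fun m hm => ⟨evaln_isSome_mono (le_max_left _ _) (hs m hm),
    evaln_isSome_mono (le_max_right _ _) (ht m hm)⟩⟩

theorem pair_le_pair {a b c d : ℕ} (hac : a ≤ c) (hbd : b ≤ d) : Nat.pair a b ≤ Nat.pair c d := by
  rcases hac.eq_or_lt with rfl | hac
  · rcases hbd.eq_or_lt with rfl | hbd
    · rfl
    · exact (Nat.pair_lt_pair_right _ hbd).le
  · refine (Nat.pair_lt_pair_left _ hac).le.trans ?_
    rcases hbd.eq_or_lt with rfl | hbd
    · rfl
    · exact (Nat.pair_lt_pair_right _ hbd).le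

theorem HaltsWithin.dom_isSome {n x s : ℕ} (h : HaltsWithin n x s) :
    (Code.evaln s (Denumerable.ofNat Code n.unpair.1) x).isSome :=
  (h x (Nat.lt_succ_of_le (Nat.left_le_pair x x))).1

theorem HaltsWithin.lt_isSome {n x s a b t : ℕ} (h : HaltsWithin n x s) (ha : a ≤ x) (hb : b ≤ x)
    (hst : s ≤ t) : (Code.evaln t (Denumerable.ofNat Code n.unpair.2) (Nat.pair a b)).isSome :=
  evaln_isSome_mono hst (h _ (Nat.lt_succ_of_le (pair_le_pair ha hb))).2

theorem IsCertified.mem_dom {n p : ℕ} (h : IsCertified n p) :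
    p.unpair.1 ∈ (linOrdOfCodes n).dom :=
  (evaln_eq_some_iff h.1.dom_isSome).1 h.2.2

theorem IsCertified.ext {n p q : ℕ} (hp : IsCertified n p) (hq : IsCertified n q)
    (h : p.unpair.1 = q.unpair.1) : p = q := by
  have h2 : p.unpair.2 = q.unpair.2 := by
    rcases lt_trichotomy p.unpair.2 q.unpair.2 with hlt | he | hlt
    · exact absurd (h ▸ hp.1) (hq.2.1 _ hlt)
    · exact he
    · exact absurd (h ▸ hq.1) (hp.2.1 _ hlt)
  rw [← Nat.pair_unpair p, ← Nat.pair_unpair q, h, h2]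

theorem exists_isCertified {n x : ℕ} (h : DecidesLinOrd n) (hx : x ∈ (linOrdOfCodes n).dom) :
    ∃ p, IsCertified n p ∧ p.unpair.1 = x := by
  classical
  have hex := exists_haltsWithin h x
  refine ⟨Nat.pair x (Nat.find hex), ?_, by simp⟩
  simp only [IsCertified, Nat.unpair_pair]
  exact ⟨Nat.find_spec hex, fun s hs => Nat.find_min hex hs,
    (evaln_eq_some_iff (Nat.find_spec hex).dom_isSome).2 hx⟩

theorem certifiedLt_iff {n p q : ℕ} (hp : IsCertified n p) (hq : IsCertified n q) :
    CertifiedLt n p q ↔ (linOrdOfCodes n).lt p.unpair.1 q.unpair.1 := by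
  have hs : (Code.evaln (p.unpair.2 + q.unpair.2) (Denumerable.ofNat Code n.unpair.2)
      (Nat.pair p.unpair.1 q.unpair.1)).isSome := by
    rcases le_total p.unpair.1 q.unpair.1 with h | h
    · exact hq.1.lt_isSome h le_rfl (Nat.le_add_left _ _)
    · exact hp.1.lt_isSome le_rfl h (Nat.le_add_right _ _)
  exact ⟨fun h => (evaln_eq_some_iff hs).1 h.2.2, fun h => ⟨hp, hq, (evaln_eq_some_iff hs).2 h⟩⟩

theorem CertifiedLt.lt {n p q : ℕ} (h : CertifiedLt n p q) :
    (linOrdOfCodes n).lt p.unpair.1 q.unpair.1 :=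
  (certifiedLt_iff h.1 h.2.1).1 h

theorem certifiedOrd_isValid {n : ℕ} (h : DecidesLinOrd n) : (certifiedOrd n).IsValid := by
  obtain ⟨-, hirr, htrans, htot⟩ := h.2.2
  refine ⟨fun a b hab => ⟨hab.1, hab.2.1⟩, fun a haa => hirr _ haa.lt, fun a b c hab hbc =>
    (certifiedLt_iff hab.1 hbc.2.1).2 (htrans _ _ _ hab.lt hbc.lt), fun a ha b hb => ?_⟩
  rcases htot _ ha.mem_dom _ hb.mem_dom with he | hlt | hlt
  · exact .inl (ha.ext hb he)
  · exact .inr (.inl ((certifiedLt_iff ha hb).2 hlt))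
  · exact .inr (.inr ((certifiedLt_iff hb ha).2 hlt))

theorem certifiedOrd_illFounded {n : ℕ} (h : DecidesLinOrd n)
    (hill : (linOrdOfCodes n).IllFounded) : (certifiedOrd n).IllFounded := by
  obtain ⟨d, hd⟩ := hill
  choose p hp hpd using fun k => exists_isCertified h (hd k).1
  refine ⟨p, fun k => ⟨hp k, (certifiedLt_iff (hp _) (hp _)).2 ?_⟩⟩
  rw [hpd, hpd]
  exact (hd k).2

theorem IsDescSeq.of_certifiedOrd {n : ℕ} {d : ℕ → ℕ} (hd : IsDescSeq (certifiedOrd n) d) :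
    IsDescSeq (linOrdOfCodes n) fun k => (d k).unpair.1 :=
  fun k => ⟨(hd k).1.mem_dom, (hd k).2.lt⟩

theorem LinOrd.IllFounded.decidesLinOrd {n : ℕ} (h : (linOrdAt n).IllFounded) :
    DecidesLinOrd n := by
  by_contra hn
  obtain ⟨d, hd⟩ := h
  rw [linOrdAt, if_neg hn] at hd
  exact (hd 0).2

/-! ### Primitive recursiveness -/

theorem primrec_evaln_ofNat {α : Type*} [Primcodable α] {s e m : α → ℕ} (hs : Primrec s)
    (he : Primrec e) (hm : Primrec m) :
    Primrec fun a => Code.evaln (s a) (Denumerable.ofNat Code (e a)) (m a) :=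
  Code.primrec_evaln.comp ((hs.pair ((Primrec.ofNat Code).comp he)).pair hm)

theorem primrecPred_forall_lt {α : Type*} [Primcodable α] {R : ℕ → α → Prop} {b : α → ℕ}
    (hR : PrimrecRel R) (hb : Primrec b) : PrimrecPred fun a => ∀ m < b a, R m a :=
  (hR.forall_mem_list.comp (Primrec.list_range.comp hb) Primrec.id).of_eq (by simp)

theorem primrec_unpair_fst : Primrec fun n : ℕ => n.unpair.1 := Primrec.fst.comp Primrec.unpair

theorem primrec_unpair_snd : Primrec fun n : ℕ => n.unpair.2 := Primrec.snd.comp Primrec.unpair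

theorem primrecPred_haltsWithin {α : Type*} [Primcodable α] {n x s : α → ℕ} (hn : Primrec n)
    (hx : Primrec x) (hs : Primrec s) : PrimrecPred fun a => HaltsWithin (n a) (x a) (s a) := by
  have hsome : ∀ {e : α → ℕ}, Primrec e → PrimrecPred fun p : ℕ × α =>
      ((Code.evaln (s p.2) (Denumerable.ofNat Code (e p.2)) p.1).isSome : Prop) := fun he =>
    Primrec.eq.comp (Primrec.option_isSome.comp (primrec_evaln_ofNat (hs.comp .snd)
      (he.comp .snd) .fst)) (.const true)
  exact primrecPred_forall_lt
    ((hsome (primrec_unpair_fst.comp hn)).and (hsome (primrec_unpair_snd.comp hn))).primrecRel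
    (Primrec.succ.comp (Primrec₂.natPair.comp hx hx))

theorem primrecPred_isCertified {α : Type*} [Primcodable α] {n p : α → ℕ} (hn : Primrec n)
    (hp : Primrec p) : PrimrecPred fun a => IsCertified (n a) (p a) := by
  have hx := primrec_unpair_fst.comp hp
  have hs := primrec_unpair_snd.comp hp
  refine (primrecPred_haltsWithin hn hx hs).and (.and (primrecPred_forall_lt
    (R := fun s a => ¬ HaltsWithin (n a) (p a).unpair.1 s) ?_ hs) ?_)
  · exact (primrecPred_haltsWithin (hn.comp .snd) (hx.comp .snd) .fst).not.primrecRel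
  · exact Primrec.eq.comp (primrec_evaln_ofNat hs (primrec_unpair_fst.comp hn) hx) (.const _)

theorem primrecPred_certifiedLt {α : Type*} [Primcodable α] {n p q : α → ℕ} (hn : Primrec n)
    (hp : Primrec p) (hq : Primrec q) : PrimrecPred fun a => CertifiedLt (n a) (p a) (q a) := by
  refine (primrecPred_isCertified hn hp).and ((primrecPred_isCertified hn hq).and ?_)
  exact Primrec.eq.comp (primrec_evaln_ofNat
    (Primrec.nat_add.comp (primrec_unpair_snd.comp hp) (primrec_unpair_snd.comp hq))
    (primrec_unpair_snd.comp hn)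
    (Primrec₂.natPair.comp (primrec_unpair_fst.comp hp) (primrec_unpair_fst.comp hq))) (.const _)

theorem primrec_greedyStep_certifiedOrd {α : Type*} [Primcodable α] {n i m c : α → ℕ}
    (hn : Primrec n) (hi : Primrec i) (hm : Primrec m) (hc : Primrec c) :
    Primrec fun a => greedyStep (certifiedOrd (n a)) (i a) (m a) (c a) := by
  classical
  have hdom := primrecPred_isCertified hn hm
  have hbelow := primrecPred_certifiedLt hn hm (Primrec.nat_sub.comp hi (.const 1))
  have habove := primrecPred_certifiedLt hn (Primrec.nat_sub.comp hc (.const 1)) hm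
  exact Primrec.ite ((hdom.and (.or (Primrec.eq.comp hi (.const 0)) hbelow)).and
    (.or (Primrec.eq.comp hc (.const 0)) habove)) (Primrec.succ.comp hm) hc

theorem primrec_greedyMax_certifiedOrd {α : Type*} [Primcodable α] {n i b : α → ℕ}
    (hn : Primrec n) (hi : Primrec i) (hb : Primrec b) :
    Primrec fun a => greedyMax (certifiedOrd (n a)) (i a) (b a) :=
  Primrec.nat_rec' (h := fun a p => greedyStep (certifiedOrd (n a)) (i a) p.1 p.2) hb (.const 0)
    (primrec_greedyStep_certifiedOrd (hn.comp .fst) (hi.comp .fst) (Primrec.fst.comp .snd)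
      (Primrec.snd.comp .snd))

/-- Uniformly primitive recursive predicates have primitive recursively computable indices. -/
theorem exists_primrec_index {R : ℕ → ℕ → Prop} (hR : PrimrecRel R) :
    ∃ h : ℕ → ℕ, Primrec h ∧ ∀ n m, (codeFn (h n) m).Dom ∧
      (codeFn (h n) m = Part.some 1 ↔ R n m) := by
  classical
  have hχ : Primrec fun p : ℕ => if R p.unpair.1 p.unpair.2 then 1 else 0 :=
    Primrec.ite (hR.comp primrec_unpair_fst primrec_unpair_snd) (.const 1) (.const 0)
  obtain ⟨c, hc⟩ := Code.exists_code.1 (Nat.Partrec.of_primrec (Primrec.nat_iff.1 hχ))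
  refine ⟨fun n => Encodable.encode (Code.curry c n),
    Primrec.encode.comp (Code.primrec₂_curry.comp (.const c) .id), fun n m => ?_⟩
  have : codeFn (Encodable.encode (Code.curry c n)) m = Part.some (if R n m then 1 else 0) := by
    rw [codeFn, Denumerable.ofNat_encode, Code.eval_curry, hc]
    simp
  rw [this]
  exact ⟨trivial, by simp⟩

theorem exists_primrec_index_certifiedOrd :
    ∃ h : ℕ → ℕ, Primrec h ∧ ∀ n, DecidesLinOrd n → linOrdAt (h n) = certifiedOrd n := by
  obtain ⟨u, hu, hu'⟩ := exists_primrec_index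
    (PrimrecPred.primrecRel (primrecPred_isCertified Primrec.fst Primrec.snd))
  obtain ⟨v, hv, hv'⟩ := exists_primrec_index (R := fun n m => CertifiedLt n m.unpair.1 m.unpair.2)
    (primrecPred_certifiedLt Primrec.fst (primrec_unpair_fst.comp .snd)
      (primrec_unpair_snd.comp .snd)).primrecRel
  refine ⟨fun n => Nat.pair (u n) (v n), Primrec₂.natPair.comp hu hv, fun n hn => ?_⟩
  have heq : linOrdOfCodes (Nat.pair (u n) (v n)) = certifiedOrd n := by
    simp [linOrdOfCodes, certifiedOrd, hu', hv']
  have hdec : DecidesLinOrd (Nat.pair (u n) (v n)) :=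
    ⟨fun m => by simpa using (hu' n m).1, fun m => by simpa using (hv' n m).1,
      heq ▸ certifiedOrd_isValid hn⟩
  rw [linOrdAt, if_pos hdec, heq]

theorem recursiveIn_greedySeq_certifiedOrd (f : ℕ → ℕ) {h : ℕ → ℕ} (hh : Primrec h) :
    RecursiveIn f ((fun p : ℕ => greedySeq (certifiedOrd p.unpair.1)
      (fun k => f (Nat.pair (h p.unpair.1) k)) p.unpair.2 : ℕ → ℕ) : ℕ →. ℕ) := by
  have hy := primrec_unpair_fst.comp primrec_unpair_snd
  have hbound := RecursiveIn.comp_total (O := f) .oracle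
    (.of_primrec (Primrec₂.natPair.comp (hh.comp primrec_unpair_fst) hy))
  have hstep := RecursiveIn.of_primrec (O := f) (primrec_greedyMax_certifiedOrd
    (primrec_unpair_fst.comp primrec_unpair_fst)
    (primrec_unpair_snd.comp (primrec_unpair_snd.comp primrec_unpair_fst))
    (Primrec.succ.comp primrec_unpair_snd))
  have hrec := RecursiveIn.prec_total (.of_primrec (.const 0))
    (hstep.comp_total ((RecursiveIn.of_primrec .id).pair_total hbound))
  simpa [greedySeq] using hrec

/-- If every ill-founded `L_n` has a descending sequence majorized by the
`n`-th column of `f`, then `f` is loquaciously high for descending sequences. -/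
theorem majorizing_columns_loqHighForDS (f : ℕ → ℕ)
    (hf : ∀ n, (linOrdAt n).IllFounded →
      ∃ d : ℕ → ℕ, IsDescSeq (linOrdAt n) d ∧ ∀ k, d k ≤ f (Nat.pair n k)) :
    ∃ g : ℕ × ℕ → ℕ, ComputableIn f g ∧
      ∀ n, (linOrdAt n).IllFounded → IsDescSeq (linOrdAt n) fun k => g (n, k) := by
  obtain ⟨h, hh, hcert⟩ := exists_primrec_index_certifiedOrd
  refine ⟨fun p => (greedySeq (certifiedOrd p.1) (fun k => f (Nat.pair (h p.1) k))
    (p.2 + 1) - 1).unpair.1, ?_, fun n hill => ?_⟩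
  · have hshift : Primrec fun p : ℕ => Nat.pair p.unpair.1 (p.unpair.2 + 1) :=
      Primrec₂.natPair.comp primrec_unpair_fst (Primrec.succ.comp primrec_unpair_snd)
    have hout : Primrec fun p : ℕ => (p - 1).unpair.1 :=
      primrec_unpair_fst.comp (Primrec.nat_sub.comp .id (.const 1))
    have hrec := (RecursiveIn.of_primrec hout).comp_total
      ((recursiveIn_greedySeq_certifiedOrd f hh).comp_total (.of_primrec hshift))
    exact hrec.of_eq fun p => by simp
  · have hn := hill.decidesLinOrd
    have hL : linOrdAt n = linOrdOfCodes n := if_pos hn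
    rw [hL] at hill ⊢
    obtain ⟨d, hd, hdf⟩ := hf (h n) (by rw [hcert n hn]; exact certifiedOrd_illFounded hn hill)
    rw [hcert n hn] at hd
    exact (isDescSeq_greedySeq (certifiedOrd_isValid hn) hd hdf).of_certifiedOrd

end CFT
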